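/- Let (γ_1, γ_2) be the bad pair γ_1 = e_i + e_j, γ_2 = 2e_i (1 ≤ i < j ≤ n) in the root system C_n, and let w be an element of the Weyl group with w ≤ w_0 (Bruhat order, w_0 the reflection in the highest root 2e_1) such that w(γ_1) < 0 and w(γ_2) < 0. Then w admits a factorization w = w'_1 · σ · w'_2 where σ = s_{α_{j−1}} s_{α_j} ⋯ s_{α_{n−1}} s_β s_{α_{n−1}} ⋯ s_{α_{i+1}} s_{α_i}, w'_1 ≤ s_{α_1}⋯s_{α_{j−2}}, and w'_2 ≤ s_{α_{i−2}}⋯s_{α_1} (in Bruhat order). -/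

import Mathlib

namespace CnRoots

/-- The standard basis vector `e_i` of `ℚ^n` (`1`-indexed: `1 ≤ i ≤ n`). -/
def e (n i : ℕ) : Fin n → ℚ := fun j => if (j : ℕ) + 1 = i then 1 else 0

/-- The standard inner product on `ℚ^n`. -/
def inn {n : ℕ} (x y : Fin n → ℚ) : ℚ := ∑ j, x j * y j

/-- The pairing `⟨x, y^∨⟩ = 2(x,y)/(y,y)` of a vector with the coroot of `y`. -/
def pairing {n : ℕ} (x y : Fin n → ℚ) : ℚ := 2 * inn x y / inn y y

/-- The reflection in the root `γ`: `s_γ(δ) = δ − ⟨δ, γ^∨⟩·γ`. -/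
def sRefl {n : ℕ} (γ δ : Fin n → ℚ) : Fin n → ℚ := δ - pairing δ γ • γ

/-- The simple roots of `C_n` (`1`-indexed): `α_k = e_k − e_{k+1}` for `1 ≤ k ≤ n−1`,
and `β = 2e_n` is indexed by `k = n`. -/
def sroot (n k : ℕ) : Fin n → ℚ :=
  if k = n then (2 : ℚ) • e n n else e n k - e n (k + 1)

/-- The element of the Weyl group of `C_n` given by the word `l` in the simple
reflections: `[k₁, …, k_r] ↦ s_{k₁} ∘ ⋯ ∘ s_{k_r}`. -/
def wordMap (n : ℕ) (l : List ℕ) : (Fin n → ℚ) → (Fin n → ℚ) :=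
  l.foldr (fun k f => sRefl (sroot n k) ∘ f) id

/-- Positive roots of `C_n`. -/
def IsPosRoot (n : ℕ) (γ : Fin n → ℚ) : Prop :=
  (∃ i j : ℕ, 1 ≤ i ∧ i < j ∧ j ≤ n ∧ γ = e n i - e n j) ∨
  (∃ i j : ℕ, 1 ≤ i ∧ i < j ∧ j ≤ n ∧ γ = e n i + e n j) ∨
  (∃ i : ℕ, 1 ≤ i ∧ i ≤ n ∧ γ = (2 : ℚ) • e n i)

/-- A word in the letters `1, …, n` (indexing `s_{α_1}, …, s_{α_{n−1}}, s_β`). -/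
def Letters (n : ℕ) (l : List ℕ) : Prop := ∀ k ∈ l, 1 ≤ k ∧ k ≤ n

/-- The length of a Weyl element of `C_n`. -/
noncomputable def wlen (n : ℕ) (w : (Fin n → ℚ) → (Fin n → ℚ)) : ℕ :=
  sInf {c | ∃ l : List ℕ, Letters n l ∧ l.length = c ∧ wordMap n l = w}

/-- Bruhat order on the Weyl group of `C_n` (subword definition): `w' ≤ w` iff `w'` is
the product of a subword of some reduced word for `w`. -/
def BruhatLE (n : ℕ) (w' w : (Fin n → ℚ) → (Fin n → ℚ)) : Prop :=
  ∃ l : List ℕ, Letters n l ∧ l.length = wlen n w ∧ wordMap n l = w ∧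
    ∃ l' : List ℕ, l'.Sublist l ∧ wordMap n l' = w'

/-- The word `s_{α_1} ⋯ s_{α_{n−1}} s_β s_{α_{n−1}} ⋯ s_{α_1}` for the reflection `w₀`
in the highest root. -/
def w0Word (n : ℕ) : List ℕ :=
  List.range' 1 (n - 1) ++ [n] ++ (List.range' 1 (n - 1)).reverse

/-- The word `s_{α_{j−1}} s_{α_j} ⋯ s_{α_{n−1}} s_β s_{α_{n−1}} ⋯ s_{α_{i+1}} s_{α_i}`. -/
def sigmaWord (n i j : ℕ) : List ℕ :=
  List.range' (j - 1) (n - j + 1) ++ [n] ++ (List.range' i (n - i)).reverse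

/-- The action of a simple reflection on positions `1, …, 2n`. -/
def act (n k p : ℕ) : ℕ :=
  if p = k then k + 1 else if p = k + 1 then k
  else if p = 2 * n - k then 2 * n + 1 - k else if p = 2 * n + 1 - k then 2 * n - k else p

/-- The action of a word on positions. -/
def pact (n : ℕ) (l : List ℕ) (p : ℕ) : ℕ := l.foldr (act n) p

/-- The vector at a position. -/
def vec (n p : ℕ) : Fin n → ℚ := if p ≤ n then e n p else - e n (2 * n + 1 - p)

theorem pact_nil (n p : ℕ) : pact n [] p = p := rfl

theorem pact_cons (n k : ℕ) (l : List ℕ) (p : ℕ) :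
    pact n (k :: l) p = act n k (pact n l p) := rfl

theorem pact_append (n : ℕ) (a b : List ℕ) (p : ℕ) :
    pact n (a ++ b) p = pact n a (pact n b p) := by
  simp [pact, List.foldr_append]

theorem wordMap_nil (n : ℕ) : wordMap n [] = id := rfl

theorem wordMap_cons (n k : ℕ) (l : List ℕ) :
    wordMap n (k :: l) = sRefl (sroot n k) ∘ wordMap n l := rfl

theorem wordMap_append (n : ℕ) (a b : List ℕ) :
    wordMap n (a ++ b) = wordMap n a ∘ wordMap n b := by
  induction a with
  | nil => rfl
  | cons k a ih => simp [wordMap_cons, ih, Function.comp_assoc]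

theorem inn_add_left {n : ℕ} (x y z : Fin n → ℚ) : inn (x + y) z = inn x z + inn y z := by
  simp [inn, add_mul, Finset.sum_add_distrib]

theorem inn_smul_left {n : ℕ} (c : ℚ) (x z : Fin n → ℚ) : inn (c • x) z = c * inn x z := by
  simp [inn, Finset.mul_sum, mul_assoc]

theorem inn_comm {n : ℕ} (x y : Fin n → ℚ) : inn x y = inn y x := by
  simp [inn, mul_comm]

theorem inn_sub_left {n : ℕ} (x y z : Fin n → ℚ) : inn (x - y) z = inn x z - inn y z := by
  simp [inn, sub_mul, Finset.sum_sub_distrib]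

theorem inn_sub_right {n : ℕ} (x y z : Fin n → ℚ) : inn z (x - y) = inn z x - inn z y := by
  rw [inn_comm, inn_sub_left, inn_comm x, inn_comm y]

theorem inn_smul_right {n : ℕ} (c : ℚ) (x z : Fin n → ℚ) : inn z (c • x) = c * inn z x := by
  rw [inn_comm, inn_smul_left, inn_comm x]

theorem inn_e_right {n : ℕ} (x : Fin n → ℚ) (k : ℕ) (h : k < n) :
    inn x (e n (k + 1)) = x ⟨k, h⟩ := by
  unfold inn e
  rw [Finset.sum_eq_single ⟨k, h⟩]
  · simp
  · intro b _ hb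
    have : (b : ℕ) ≠ k := fun hh => hb (Fin.ext hh)
    simp [this]
  · simp

theorem inn_e_e {n : ℕ} (p k : ℕ) (h1 : 1 ≤ k) (h : k ≤ n) :
    inn (e n p) (e n k) = if p = k then 1 else 0 := by
  obtain ⟨k, rfl⟩ := Nat.exists_eq_add_of_le' h1
  rw [inn_e_right _ _ (by omega)]
  simp [e, eq_comm]

theorem sRefl_add {n : ℕ} (g x y : Fin n → ℚ) : sRefl g (x + y) = sRefl g x + sRefl g y := by
  unfold sRefl pairing
  rw [inn_add_left, mul_add, add_div, add_smul]
  abel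

theorem sRefl_smul {n : ℕ} (c : ℚ) (g x : Fin n → ℚ) : sRefl g (c • x) = c • sRefl g x := by
  unfold sRefl pairing
  rw [inn_smul_left, smul_sub, smul_smul]
  congr 2
  ring

theorem sRefl_neg {n : ℕ} (g x : Fin n → ℚ) : sRefl g (-x) = - sRefl g x := by
  have := sRefl_smul (-1) g x
  simpa using this

theorem wordMap_add (n : ℕ) (l : List ℕ) (x y : Fin n → ℚ) :
    wordMap n l (x + y) = wordMap n l x + wordMap n l y := by
  induction l with
  | nil => rfl
  | cons k l ih => simp [wordMap_cons, ih, sRefl_add]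

theorem wordMap_smul (n : ℕ) (l : List ℕ) (c : ℚ) (x : Fin n → ℚ) :
    wordMap n l (c • x) = c • wordMap n l x := by
  induction l with
  | nil => rfl
  | cons k l ih => simp [wordMap_cons, ih, sRefl_smul]

theorem sRefl_e_lt (n k p : ℕ) (hk : 1 ≤ k) (hkn : k < n) :
    sRefl (sroot n k) (e n p) = e n (if p = k then k + 1 else if p = k + 1 then k else p) := by
  have h2 : inn (sroot n k) (sroot n k) = 2 := by
    rw [sroot, if_neg (by omega), inn_sub_right, inn_sub_left, inn_sub_left,
      inn_e_e _ _ (by omega) (by omega), inn_e_e _ _ (by omega) (by omega),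
      inn_e_e _ _ (by omega) (by omega), inn_e_e _ _ (by omega) (by omega)]
    simp
    norm_num
  have h3 : inn (e n p) (sroot n k) = (if p = k then 1 else 0) - (if p = k + 1 then 1 else 0) := by
    rw [sroot, if_neg (by omega), inn_sub_right,
      inn_e_e _ _ (by omega) (by omega), inn_e_e _ _ (by omega) (by omega)]
  unfold sRefl pairing
  have h4 : sroot n k = e n k - e n (k + 1) := by rw [sroot, if_neg (by omega)]
  rw [h2, h3, h4]
  by_cases a : p = k
  · subst a; simp
  · by_cases b : p = k + 1
    · subst b; simp
    · simp [a, b]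

theorem sRefl_e_n (n p : ℕ) (hn : 1 ≤ n) :
    sRefl (sroot n n) (e n p) = if p = n then - e n n else e n p := by
  have h2 : inn (sroot n n) (sroot n n) = 4 := by
    rw [sroot, if_pos rfl, inn_smul_right, inn_smul_left, inn_e_e _ _ (by omega) (by omega)]
    simp
    norm_num
  have h3 : inn (e n p) (sroot n n) = 2 * (if p = n then 1 else 0) := by
    rw [sroot, if_pos rfl, inn_smul_right, inn_e_e _ _ (by omega) (by omega)]
  unfold sRefl pairing
  rw [h2, h3, sroot, if_pos rfl]
  by_cases a : p = n
  · subst a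
    ext t
    simp
    ring
  · simp [a]

theorem act_range (n k p : ℕ) (hk : 1 ≤ k) (hkn : k ≤ n) (hp : 1 ≤ p) (hp2 : p ≤ 2 * n) :
    1 ≤ act n k p ∧ act n k p ≤ 2 * n := by
  unfold act; split_ifs <;> omega

theorem act_symm (n k p : ℕ) (hk : 1 ≤ k) (hkn : k ≤ n) (hp : 1 ≤ p) (hp2 : p ≤ 2 * n) :
    act n k (2 * n + 1 - p) = 2 * n + 1 - act n k p := by
  unfold act; split_ifs <;> omega

theorem act_bd (n k p : ℕ) (hk : 1 ≤ k) (hkn : k ≤ n) :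
    act n k p ≤ p + 1 ∧ p ≤ act n k p + 1 ∧ (act n k p = p + 1 → k = p ∨ k = 2 * n - p) := by
  unfold act; split_ifs <;> omega

theorem vec_symm (n p : ℕ) (hp : 1 ≤ p) (hp2 : p ≤ 2 * n) :
    vec n (2 * n + 1 - p) = - vec n p := by
  unfold vec
  by_cases h : p ≤ n
  · rw [if_neg (by omega), if_pos h]
    congr 2
    omega
  · rw [if_pos (by omega), if_neg h, neg_neg]

theorem sRefl_vec_le (n k p : ℕ) (hk : 1 ≤ k) (hkn : k ≤ n) (hp : 1 ≤ p) (hp2 : p ≤ n) :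
    sRefl (sroot n k) (vec n p) = vec n (act n k p) := by
  rw [vec, if_pos hp2]
  rcases Nat.lt_or_ge k n with h | h
  · rw [sRefl_e_lt n k p hk h]
    have : act n k p = (if p = k then k + 1 else if p = k + 1 then k else p) := by
      unfold act; split_ifs <;> omega
    have h5 : (if p = k then k + 1 else if p = k + 1 then k else p) ≤ n := by
      split_ifs <;> omega
    rw [this, vec, if_pos h5]
  · obtain rfl : k = n := by omega
    rw [sRefl_e_n _ _ hk]
    by_cases a : p = k
    · subst a
      simp [act, vec]
      congr 1; omega
    · have : act k k p = p := by unfold act; split_ifs <;> omega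
      rw [this, if_neg a, vec, if_pos hp2]

theorem sRefl_vec (n k p : ℕ) (hk : 1 ≤ k) (hkn : k ≤ n) (hp : 1 ≤ p) (hp2 : p ≤ 2 * n) :
    sRefl (sroot n k) (vec n p) = vec n (act n k p) := by
  rcases le_or_gt p n with h | h
  · exact sRefl_vec_le n k p hk hkn hp h
  · have h1 := vec_symm n (2 * n + 1 - p) (by omega) (by omega)
    have h2 : 2 * n + 1 - (2 * n + 1 - p) = p := by omega
    rw [h2] at h1
    have h3 := act_symm n k p hk hkn hp hp2
    have h4 := act_range n k p hk hkn hp hp2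
    rw [h1, sRefl_neg, sRefl_vec_le n k _ hk hkn (by omega) (by omega), h3,
      vec_symm n _ h4.1 h4.2, neg_neg]

theorem pact_range (n : ℕ) (l : List ℕ) (hl : Letters n l) (p : ℕ) (hp : 1 ≤ p)
    (hp2 : p ≤ 2 * n) : 1 ≤ pact n l p ∧ pact n l p ≤ 2 * n := by
  induction l with
  | nil => exact ⟨hp, hp2⟩
  | cons k l ih =>
    have ih := ih (fun x hx => hl x (by simp [hx]))
    have hk := hl k (by simp)
    exact act_range n k _ hk.1 hk.2 ih.1 ih.2

theorem wordMap_vec (n : ℕ) (l : List ℕ) (hl : Letters n l) (p : ℕ) (hp : 1 ≤ p)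
    (hp2 : p ≤ 2 * n) : wordMap n l (vec n p) = vec n (pact n l p) := by
  induction l with
  | nil => rfl
  | cons k l ih =>
    have hl' : Letters n l := fun x hx => hl x (by simp [hx])
    have hk := hl k (by simp)
    have hr := pact_range n l hl' p hp hp2
    rw [wordMap_cons, Function.comp_apply, ih hl', sRefl_vec n k _ hk.1 hk.2 hr.1 hr.2, pact_cons]

theorem pact_symm (n : ℕ) (l : List ℕ) (hl : Letters n l) (p : ℕ) (hp : 1 ≤ p)
    (hp2 : p ≤ 2 * n) : pact n l (2 * n + 1 - p) = 2 * n + 1 - pact n l p := by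
  induction l with
  | nil => rfl
  | cons k l ih =>
    have hl' : Letters n l := fun x hx => hl x (by simp [hx])
    have hk := hl k (by simp)
    have hr := pact_range n l hl' p hp hp2
    rw [pact_cons, ih hl', act_symm n k _ hk.1 hk.2 hr.1 hr.2, pact_cons]

theorem pact_bd (n : ℕ) (l : List ℕ) (hl : Letters n l) (p : ℕ) :
    pact n l p ≤ p + l.length ∧ p ≤ pact n l p + l.length := by
  induction l with
  | nil => simp [pact_nil]
  | cons k l ih =>
    have ih := ih (fun x hx => hl x (by simp [hx]))
    have hk := hl k (by simp)
    have := act_bd n k (pact n l p) hk.1 hk.2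
    rw [pact_cons, List.length_cons]
    omega

theorem pact_unique (n : ℕ) (l l' : List ℕ) (hl : Letters n l) (hl' : Letters n l') (p : ℕ)
    (hlen : l.length = l'.length)
    (h : pact n l p = p + l.length) (h' : pact n l' p = p + l'.length) : l = l' := by
  induction l generalizing l' with
  | nil => cases l' with
    | nil => rfl
    | cons => simp at hlen
  | cons k l ih => cases l' with
    | nil => simp at hlen
    | cons k' l' =>
      have hl1 : Letters n l := fun x hx => hl x (by simp [hx])
      have hl1' : Letters n l' := fun x hx => hl' x (by simp [hx])
      have hk := hl k (by simp)
      have hk' := hl' k' (by simp)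
      simp only [List.length_cons, pact_cons] at h h' hlen
      have a := act_bd n k (pact n l p) hk.1 hk.2
      have a' := act_bd n k' (pact n l' p) hk'.1 hk'.2
      have b := pact_bd n l hl1 p
      have b' := pact_bd n l' hl1' p
      have c := a.2.2 (by omega)
      have c' := a'.2.2 (by omega)
      rw [ih l' hl1 hl1' (by omega) (by omega) (by omega)]
      congr 1
      omega

/-- The height functional. -/
def ht {n : ℕ} (x : Fin n → ℚ) : ℚ := inn x (fun j => (n : ℚ) - (j : ℕ))

theorem ht_e (n k : ℕ) (h1 : 1 ≤ k) (h : k ≤ n) : ht (e n k) = n + 1 - k := by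
  obtain ⟨k, rfl⟩ := Nat.exists_eq_add_of_le' h1
  rw [ht, inn_comm, inn_e_right _ _ (by omega)]
  push_cast; ring

theorem ht_add {n : ℕ} (x y : Fin n → ℚ) : ht (x + y) = ht x + ht y := inn_add_left _ _ _
theorem ht_sub {n : ℕ} (x y : Fin n → ℚ) : ht (x - y) = ht x - ht y := inn_sub_left _ _ _
theorem ht_smul {n : ℕ} (c : ℚ) (x : Fin n → ℚ) : ht (c • x) = c * ht x := inn_smul_left _ _ _
theorem ht_neg {n : ℕ} (x : Fin n → ℚ) : ht (-x) = - ht x := by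
  have := ht_smul (-1) x
  simpa using this

theorem ht_vec_le (n p : ℕ) (hp : 1 ≤ p) (h : p ≤ n) : ht (vec n p) = n + 1 - p := by
  rw [vec, if_pos h, ht_e n p hp h]

theorem ht_vec_gt (n p : ℕ) (hp : n < p) (h : p ≤ 2 * n) : ht (vec n p) = n - p := by
  rw [vec, if_neg (by omega), ht_neg, ht_e n _ (by omega) (by omega),
    Nat.cast_sub (by omega)]
  push_cast; ring

theorem vec_inj (n p q : ℕ) (hp : 1 ≤ p) (hp2 : p ≤ 2 * n) (hq : 1 ≤ q) (hq2 : q ≤ 2 * n)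
    (h : vec n p = vec n q) : p = q := by
  have h := congrArg ht h
  have key : ∀ r : ℕ, 1 ≤ r → r ≤ 2 * n →
      (r ≤ n ∧ ht (vec n r) = n + 1 - r) ∨ (n < r ∧ ht (vec n r) = n - r) := by
    intro r h1 h2
    rcases le_or_gt r n with h | h
    · exact Or.inl ⟨h, ht_vec_le n r h1 h⟩
    · exact Or.inr ⟨h, ht_vec_gt n r h h2⟩
  rcases key p hp hp2 with ⟨a, b⟩ | ⟨a, b⟩ <;> rcases key q hq hq2 with ⟨c, d⟩ | ⟨c, d⟩ <;>
    rw [b, d] at h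
  · have : (p : ℚ) = q := by linarith
    exact_mod_cast this
  · have : (p : ℚ) = q + 1 := by linarith
    have : p = q + 1 := by exact_mod_cast this
    omega
  · have : (p : ℚ) + 1 = q := by linarith
    have : p + 1 = q := by exact_mod_cast this
    omega
  · have : (p : ℚ) = q := by linarith
    exact_mod_cast this

theorem ht_pos {n : ℕ} (g : Fin n → ℚ) (h : IsPosRoot n g) : 0 < ht g := by
  rcases h with ⟨i, j, h1, h2, h3, rfl⟩ | ⟨i, j, h1, h2, h3, rfl⟩ | ⟨i, h1, h2, rfl⟩
  · rw [ht_sub, ht_e _ _ (by omega) (by omega), ht_e _ _ (by omega) (by omega)]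
    have : (i : ℚ) < j := by exact_mod_cast h2
    linarith
  · rw [ht_add, ht_e _ _ (by omega) (by omega), ht_e _ _ (by omega) (by omega)]
    have : (i : ℚ) < j := by exact_mod_cast h2
    have : (j : ℚ) ≤ n := by exact_mod_cast h3
    linarith
  · rw [ht_smul, ht_e _ _ (by omega) (by omega)]
    have : (i : ℚ) ≤ n := by exact_mod_cast h2
    linarith

theorem neg_single (n p : ℕ) (hp : 1 ≤ p) (h : IsPosRoot n (-((2 : ℚ) • vec n p))) : n < p := by
  by_contra hc
  have := ht_pos _ h
  rw [ht_neg, ht_smul, ht_vec_le n p hp (by omega)] at this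
  have : (p : ℚ) ≤ n := by exact_mod_cast (by omega : p ≤ n)
  linarith

theorem neg_pair (n p q : ℕ) (hp : n < p) (hp2 : p ≤ 2 * n) (hq : 1 ≤ q) (hq2 : q ≤ 2 * n)
    (h : IsPosRoot n (-(vec n p + vec n q))) : 2 * n + 1 < p + q := by
  have := ht_pos _ h
  rcases le_or_gt q n with hh | hh
  · rw [ht_neg, ht_add, ht_vec_gt n p hp hp2, ht_vec_le n q hq hh] at this
    have : (2 * n + 1 : ℚ) < p + q := by linarith
    exact_mod_cast this
  · omega

theorem range'_snoc (a m : ℕ) : List.range' a (m + 1) = List.range' a m ++ [a + m] := by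
  rw [List.range'_concat]; simp

theorem pact_up (n a m : ℕ) (h : a + m ≤ n) :
    pact n (List.range' a m).reverse a = a + m := by
  induction m with
  | zero => rfl
  | succ m ih =>
    rw [range'_snoc, List.reverse_append]
    simp only [List.reverse_cons, List.reverse_nil, List.nil_append, List.cons_append, pact_cons]
    rw [ih (by omega)]
    simp [act]; omega

theorem pact_down (n a m : ℕ) (h : a + m ≤ n) :
    pact n (List.range' a m) (a + m) = a := by
  induction m generalizing a with
  | zero => rfl
  | succ m ih =>
    rw [List.range'_succ, pact_cons]
    have := ih (a + 1) (by omega)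
    rw [show a + 1 + m = a + (m + 1) by ring] at this
    rw [this]
    simp [act]

theorem pact_fix (n : ℕ) (l : List ℕ) (p : ℕ) (hp : p ≤ n)
    (hl : ∀ k ∈ l, (k + 1 < p ∨ p < k) ∧ k ≤ n) (hn : ∀ k ∈ l, k < n ∨ p < n) :
    pact n l p = p := by
  induction l with
  | nil => rfl
  | cons k l ih =>
    have h1 := hl k (by simp)
    have h2 := hn k (by simp)
    rw [pact_cons, ih (fun x hx => hl x (by simp [hx])) (fun x hx => hn x (by simp [hx]))]
    unfold act; split_ifs <;> omega

theorem pact_le (n m : ℕ) (l : List ℕ) (p : ℕ) (hp : p ≤ m) (hm : m ≤ n)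
    (hl : ∀ k ∈ l, k < m) :
    pact n l p ≤ m := by
  induction l with
  | nil => exact hp
  | cons k l ih =>
    have h1 := hl k (by simp)
    have := ih (fun x hx => hl x (by simp [hx]))
    rw [pact_cons]
    unfold act; split_ifs <;> omega

theorem lemV (n m i : ℕ) (hm : m < n) (hi : 1 ≤ i) (him : i ≤ m + 1) (v : List ℕ)
    (hv : v.Sublist (List.range' 1 m).reverse) (h : pact n v i = m + 1) :
    ∃ v', v = (List.range' i (m + 1 - i)).reverse ++ v' ∧
      v'.Sublist (List.range' 1 (i - 2)).reverse := by
  induction m generalizing v with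
  | zero =>
    obtain rfl : i = 1 := by omega
    exact ⟨v, by simp, by simpa using hv⟩
  | succ m ih =>
    rw [range'_snoc, List.reverse_append] at hv
    simp only [List.reverse_cons, List.reverse_nil, List.nil_append, List.cons_append] at hv
    have hlet : ∀ v0 : List ℕ, v0.Sublist (List.range' 1 m).reverse → ∀ k ∈ v0, k < m + 1 := by
      intro v0 h0 k hk
      have := h0.subset hk
      simp at this
      omega
    rcases Nat.lt_or_ge i (m + 2) with hlt | hge
    · rcases List.sublist_cons_iff.1 hv with hv | ⟨v0, rfl, hv0⟩
      · have := pact_le n (m + 1) v i (by omega) (by omega) (hlet v hv)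
        omega
      · have h1 := pact_le n (m + 1) v0 i (by omega) (by omega) (hlet v0 hv0)
        rw [pact_cons] at h
        have h2 : pact n v0 i = m + 1 := by
          unfold act at h; split_ifs at h <;> omega
        obtain ⟨v', rfl, hv'⟩ := ih (by omega) (by omega) v0 hv0 h2
        refine ⟨v', ?_, hv'⟩
        rw [show m + 1 + 1 - i = (m + 1 - i) + 1 by omega, range'_snoc, List.reverse_append]
        simp
        omega
    · obtain rfl : i = m + 2 := by omega
      rcases List.sublist_cons_iff.1 hv with hv | ⟨v0, rfl, hv0⟩
      · exact ⟨v, by simp, by simpa using hv⟩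
      · rw [pact_cons, pact_fix n v0 (m + 2) (by omega)] at h
        · unfold act at h; split_ifs at h <;> omega
        · intro k hk; have := hlet v0 hv0 k hk; omega
        · intro k hk; have := hlet v0 hv0 k hk; omega

theorem lemU (n m a : ℕ) (hm : m < n) (ha : 1 ≤ a) (ham : a ≤ m) (u : List ℕ)
    (hu : u.Sublist (List.range' 1 m)) (h : pact n u (m + 1) < pact n u a) :
    ∃ u', u = u' ++ List.range' a (m + 1 - a) ∧ u'.Sublist (List.range' 1 (a - 1)) := by
  induction m generalizing u with
  | zero => omega
  | succ m ih =>
    rw [range'_snoc] at hu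
    obtain ⟨u0, x, rfl, hu0, hx⟩ := List.sublist_append_iff.1 hu
    have hlet : ∀ k ∈ u0, k < m + 1 := by
      intro k hk
      have := hu0.subset hk
      simp at this
      omega
    rcases List.sublist_singleton.1 hx with rfl | rfl
    · rw [List.append_nil] at h
      have h1 := pact_le n (m + 1) u0 a (by omega) (by omega) hlet
      rw [pact_fix n u0 (m + 1 + 1) (by omega)] at h
      · omega
      · intro k hk; have := hlet k hk; omega
      · intro k hk; have := hlet k hk; omega
    · rw [pact_append, pact_append] at h
      rcases Nat.lt_or_ge a (m + 1) with hlt | hge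
      · have e1 : pact n [1 + m] (m + 1 + 1) = m + 1 := by
          rw [pact_cons, pact_nil]; unfold act; split_ifs <;> omega
        have e2 : pact n [1 + m] a = a := by
          rw [pact_cons, pact_nil]; unfold act; split_ifs <;> omega
        rw [e1, e2] at h
        obtain ⟨u', rfl, hu'⟩ := ih (by omega) (by omega) u0 hu0 h
        refine ⟨u', ?_, hu'⟩
        rw [show m + 1 + 1 - a = (m + 1 - a) + 1 by omega, range'_snoc]
        simp
        omega
      · obtain rfl : a = m + 1 := by omega
        refine ⟨u0, ?_, by simpa using hu0⟩
        simp [add_comm]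

theorem pact_shift (n i m j : ℕ) (hij : i < j) (hj : j ≤ i + m) (hn : i + m ≤ n) :
    pact n (List.range' i m).reverse j = j - 1 := by
  induction m with
  | zero => omega
  | succ m ih =>
    rw [range'_snoc, List.reverse_append]
    simp only [List.reverse_cons, List.reverse_nil, List.nil_append, List.cons_append, pact_cons]
    rcases Nat.lt_or_ge (i + m) j with h | h
    · rw [pact_fix n _ j (by omega)]
      · unfold act; split_ifs <;> omega
      · intro k hk; simp at hk; omega
      · intro k hk; simp at hk; omega
    · rw [ih (by omega) (by omega)]
      unfold act; split_ifs <;> omega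

theorem w0_letters (n : ℕ) (hn : 2 ≤ n) : Letters n (w0Word n) := by
  intro k hk
  simp [w0Word] at hk
  omega

theorem w0_length (n : ℕ) (hn : 2 ≤ n) : (w0Word n).length = 2 * n - 1 := by
  simp [w0Word]; omega

theorem w0_pact (n : ℕ) (hn : 2 ≤ n) : pact n (w0Word n) 1 = 2 * n := by
  have hl : Letters n (List.range' 1 (n - 1)) := by
    intro k hk; simp at hk; omega
  have h1 := pact_up n 1 (n - 1) (by omega)
  have h2 := pact_down n 1 (n - 1) (by omega)
  have h3 := pact_symm n _ hl n (by omega) (by omega)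
  rw [show 1 + (n - 1) = n by omega] at h1 h2
  rw [w0Word, pact_append, pact_append, h1, pact_cons, pact_nil]
  have : act n n n = 2 * n + 1 - n := by simp [act]; omega
  rw [this, h3, h2]
  omega

theorem wlen_le (n : ℕ) (l : List ℕ) (hl : Letters n l) : wlen n (wordMap n l) ≤ l.length :=
  Nat.sInf_le ⟨l, hl, rfl, rfl⟩

theorem wlen_eq (n : ℕ) (l : List ℕ) (hl : Letters n l) (p : ℕ) (hp : 1 ≤ p) (hp2 : p ≤ 2 * n)
    (h : pact n l p = p + l.length ∨ p = pact n l p + l.length) :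
    l.length = wlen n (wordMap n l) := by
  refine le_antisymm ?_ (wlen_le n l hl)
  refine le_csInf ⟨_, l, hl, rfl, rfl⟩ ?_
  rintro c ⟨l', hl', rfl, hw⟩
  have h1 := congrFun hw (vec n p)
  rw [wordMap_vec n l hl p hp hp2, wordMap_vec n l' hl' p hp hp2] at h1
  have r := pact_range n l hl p hp hp2
  have r' := pact_range n l' hl' p hp hp2
  have h2 := vec_inj n _ _ r'.1 r'.2 r.1 r.2 h1
  have := pact_bd n l' hl' p
  omega

theorem w0_unique (n : ℕ) (hn : 2 ≤ n) (l : List ℕ) (hl : Letters n l)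
    (hlen : l.length = wlen n (wordMap n (w0Word n))) (hw : wordMap n l = wordMap n (w0Word n)) :
    l = w0Word n := by
  have hl0 := w0_letters n hn
  have hle := wlen_le n _ hl0
  have h1 := congrFun hw (vec n 1)
  rw [wordMap_vec n l hl 1 (by omega) (by omega), wordMap_vec n _ hl0 1 (by omega) (by omega)] at h1
  have r := pact_range n l hl 1 (by omega) (by omega)
  have r' := pact_range n _ hl0 1 (by omega) (by omega)
  have h2 := vec_inj n _ _ r.1 r.2 r'.1 r'.2 h1
  have h3 := w0_pact n hn
  have h4 := w0_length n hn
  have h5 := pact_bd n l hl 1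
  exact pact_unique n l _ hl hl0 1 (by omega) (by omega) (by omega)

/-- Let `(γ₁, γ₂) = (e_i + e_j, 2e_i)` (`1 ≤ i < j ≤ n`) be a bad pair
in `C_n`, and let `w ≤ w₀` (Bruhat order, `w₀` the reflection in the highest root `2e_1`)
with `w(γ₁) < 0` and `w(γ₂) < 0`.  Then `w = w₁'·σ·w₂'` with
`σ = s_{α_{j−1}} s_{α_j} ⋯ s_{α_{n−1}} s_β s_{α_{n−1}} ⋯ s_{α_{i+1}} s_{α_i}`,
`w₁' ≤ s_{α_1} ⋯ s_{α_{j−2}}` and `w₂' ≤ s_{α_{i−2}} ⋯ s_{α_1}` (in Bruhat order). -/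
theorem bad_pair_weyl_factorization (n i j : ℕ) (hn : 2 ≤ n)
    (h1i : 1 ≤ i) (hij : i < j) (hjn : j ≤ n)
    (w : (Fin n → ℚ) → (Fin n → ℚ))
    (hw : ∃ l : List ℕ, Letters n l ∧ w = wordMap n l)
    (hle : BruhatLE n w (wordMap n (w0Word n)))
    (hneg₁ : IsPosRoot n (-(w (e n i + e n j))))
    (hneg₂ : IsPosRoot n (-(w ((2 : ℚ) • e n i)))) :
    ∃ w₁ w₂ : (Fin n → ℚ) → (Fin n → ℚ),
      w = w₁ ∘ wordMap n (sigmaWord n i j) ∘ w₂ ∧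
      BruhatLE n w₁ (wordMap n (List.range' 1 (j - 2))) ∧
      BruhatLE n w₂ (wordMap n ((List.range' 1 (i - 2)).reverse)) := by
  obtain ⟨l, hl, hlen, hlw, l', hsub, rfl⟩ := hle
  obtain rfl := w0_unique n hn l hl hlen hlw
  have hl' : Letters n l' := fun k hk => hl k (hsub.subset hk)
  have ei : e n i = vec n i := by rw [vec, if_pos (by omega)]
  have ej : e n j = vec n j := by rw [vec, if_pos (by omega)]
  rw [wordMap_add, ei, ej, wordMap_vec n l' hl' i (by omega) (by omega),
    wordMap_vec n l' hl' j (by omega) (by omega)] at hneg₁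
  rw [wordMap_smul, ei, wordMap_vec n l' hl' i (by omega) (by omega)] at hneg₂
  have ri := pact_range n l' hl' i (by omega) (by omega)
  have rj := pact_range n l' hl' j (by omega) (by omega)
  have hi := neg_single n _ ri.1 hneg₂
  have hpair := neg_pair n _ _ hi ri.2 rj.1 rj.2 hneg₁
  clear hneg₁ hneg₂ ri rj
  unfold w0Word at hsub
  obtain ⟨ux, v, rfl, hux, hv⟩ := List.sublist_append_iff.1 hsub
  obtain ⟨u, x, rfl, hu, hx⟩ := List.sublist_append_iff.1 hux
  have hul : ∀ k ∈ u, k < n := by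
    intro k hk
    have := hu.subset hk
    simp at this
    omega
  have hvl : ∀ k ∈ v, k < n := by
    intro k hk
    have := hv.subset hk
    simp at this
    omega
  have hvi := pact_le n n v i (by omega) le_rfl hvl
  simp only [pact_append] at hi hpair
  rcases List.sublist_singleton.1 hx with rfl | rfl
  · have := pact_le n n u _ hvi le_rfl hul
    rw [pact_nil] at hi
    omega
  have hvn : pact n v i = (n - 1) + 1 := by
    by_contra hc
    have h1 : pact n [n] (pact n v i) ≤ n := by
      rw [pact_cons, pact_nil]; unfold act; split_ifs <;> omega
    have := pact_le n n u _ h1 le_rfl hul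
    omega
  obtain ⟨v', rfl, hv'⟩ := lemV n (n - 1) i (by omega) h1i (by omega) v hv hvn
  have hnn : n - 1 + 1 = n := by omega
  simp only [hnn] at hvn hpair hl' ⊢
  have hvj : pact n v' j = j := by
    apply pact_fix n v' j hjn
    · intro k hk
      have := hv'.subset hk
      simp at this
      omega
    · intro k hk
      have := hv'.subset hk
      simp at this
      omega
  rw [hvn, pact_append, hvj, pact_shift n i (n - i) j hij (by omega) (by omega)] at hpair
  have a1 : pact n [n] n = 2 * n + 1 - n := by
    rw [pact_cons, pact_nil]; unfold act; split_ifs <;> omega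
  have a2 : pact n [n] (j - 1) = j - 1 := by
    rw [pact_cons, pact_nil]; unfold act; split_ifs <;> omega
  have huL : Letters n u := fun k hk => hl' k (by simp [hk])
  have hru := pact_range n u huL n (by omega) (by omega)
  rw [a1, a2, pact_symm n u huL n (by omega) (by omega)] at hpair
  obtain ⟨u', rfl, hu'⟩ := lemU n (n - 1) (j - 1) (by omega) (by omega) (by omega) u hu
    (by rw [hnn]; omega)
  refine ⟨wordMap n u', wordMap n v', ?_, ?_, ?_⟩
  · rw [← wordMap_append, ← wordMap_append, sigmaWord,
      show n - 1 + 1 - (j - 1) = n - j + 1 by omega]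
    simp only [List.append_assoc]
  · have hL : Letters n (List.range' 1 (j - 2)) := by
      intro k hk; simp at hk; omega
    refine ⟨_, hL, ?_, rfl, u', by simpa [Nat.sub_sub] using hu', rfl⟩
    apply wlen_eq n _ hL (1 + (j - 2)) (by omega) (by omega)
    right
    rw [pact_down n 1 (j - 2) (by omega)]
    simp
  · have hL : Letters n (List.range' 1 (i - 2)).reverse := by
      intro k hk; simp at hk; omega
    refine ⟨_, hL, ?_, rfl, v', hv', rfl⟩
    apply wlen_eq n _ hL 1 (by omega) (by omega)
    left
    rw [pact_up n 1 (i - 2) (by omega)]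
    simp

end CnRoots
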